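/- arXiv:1504.02090 — 4 statements merged into one kernel-verified Lean document; each statement's English description precedes it below -/
import Mathlib

section
/- Let n ≥ 1, s > 0, and let Γ be a subgroup of SL₂(ℝ)ⁿ such that for every γ = (γ_1,…,γ_n) ∈ Γ, writing c_i for the lower-left entry of γ_i, either all c_i are zero or all c_i are nonzero, and such that ∏_i |c_i| ≥ s whenever the c_i are nonzero. If z, w ∈ ℍⁿ satisfy ∏_i Im z_i > 1/s and ∏_i Im w_i > 1/s and γ · z = w (coordinatewise Möbius action) for some γ ∈ Γ, then all lower-left entries c_i of γ are zero, i.e. γ is upper triangular. -/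
open scoped MatrixGroups
open UpperHalfPlane

/-- If `Γ ≤ SL₂(ℝ)ⁿ` is such that every element has either all lower-left entries zero or
all nonzero, with `∏ |c_i| ≥ s` in the latter case, then any `γ ∈ Γ` mapping a point of the
depth-`s` horoball `U(s) = {∏ Im z_i > 1/s}` into `U(s)` is upper triangular. -/
theorem upper_triangular_of_smul_horoball (n : ℕ) (hn : 1 ≤ n) (s : ℝ) (hs : 0 < s)
    (Γ : Subgroup (Fin n → SL(2, ℝ)))
    (hall : ∀ γ ∈ Γ, (∀ i, ((γ i : Matrix (Fin 2) (Fin 2) ℝ)) 1 0 = 0) ∨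
      (∀ i, ((γ i : Matrix (Fin 2) (Fin 2) ℝ)) 1 0 ≠ 0))
    (hbig : ∀ γ ∈ Γ, (∀ i, ((γ i : Matrix (Fin 2) (Fin 2) ℝ)) 1 0 ≠ 0) →
      s ≤ ∏ i, |((γ i : Matrix (Fin 2) (Fin 2) ℝ)) 1 0|)
    (z w : Fin n → UpperHalfPlane)
    (hz : 1 / s < ∏ i, (z i).im) (hw : 1 / s < ∏ i, (w i).im)
    (γ : Fin n → SL(2, ℝ)) (hγ : γ ∈ Γ) (hzw : ∀ i, (γ i) • (z i) = w i) :
    ∀ i, ((γ i : Matrix (Fin 2) (Fin 2) ℝ)) 1 0 = 0 := by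
  rcases hall γ hγ with h | h
  · exact h
  exfalso
  have hC := hbig γ hγ h
  have key : ∀ i, (z i).im * (w i).im *
      |((γ i : Matrix (Fin 2) (Fin 2) ℝ)) 1 0| ^ 2 ≤ 1 := by
    intro i
    have h0 : ((γ i) • (z i)).im =
        (z i).im / Complex.normSq (denom (γ i : GL (Fin 2) ℝ) (z i)) := by
      have := (z i).im_smul_eq_div_normSq (γ i : GL (Fin 2) ℝ)
      rw [Matrix.GeneralLinearGroup.val_det_apply] at this
      have e : (γ i) • (z i) = (γ i : GL (Fin 2) ℝ) • (z i) := rfl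
      rw [e]
      simpa using this
    rw [← hzw i, h0, sq_abs]
    have h1 := c_mul_im_sq_le_normSq_denom (γ i : GL (Fin 2) ℝ) (z i)
    have h2 := normSq_denom_pos (γ i : GL (Fin 2) ℝ) (z i).im_ne_zero
    have h3 : (z i).im * ((z i).im / Complex.normSq (denom (γ i : GL (Fin 2) ℝ) (z i))) *
        ((γ i : Matrix (Fin 2) (Fin 2) ℝ)) 1 0 ^ 2 =
        (((γ i : Matrix (Fin 2) (Fin 2) ℝ)) 1 0 * (z i).im) ^ 2 /
          Complex.normSq (denom (γ i : GL (Fin 2) ℝ) (z i)) := by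
      ring
    refine h3.trans_le ?_
    rw [div_le_one h2]
    simpa using h1
  have hprod : (∏ i, (z i).im) * (∏ i, (w i).im) *
      (∏ i, |((γ i : Matrix (Fin 2) (Fin 2) ℝ)) 1 0|) ^ 2 ≤ 1 := by
    rw [← Finset.prod_pow, ← Finset.prod_mul_distrib, ← Finset.prod_mul_distrib]
    refine Finset.prod_le_one (fun i _ => ?_) (fun i _ => key i)
    have := (z i).im_pos
    have := (w i).im_pos
    positivity
  have hs' : 0 < 1 / s := by positivity
  have h1 : 1 / s * (1 / s) < (∏ i, (z i).im) * (∏ i, (w i).im) :=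
    mul_lt_mul'' hz hw hs'.le hs'.le
  have h2 : s ^ 2 ≤ (∏ i, |((γ i : Matrix (Fin 2) (Fin 2) ℝ)) 1 0|) ^ 2 := by gcongr
  have h3 : 1 / s * (1 / s) * s ^ 2 = 1 := by field_simp
  have h4 := mul_lt_mul h1 h2 (by positivity) ((mul_pos hs' hs').trans h1).le
  linarith
end

section
/- Let F be a number field of degree n over ℚ and let 𝔫 ⊂ 𝓞_F be a nonzero ideal with absolute norm |Nm(𝔫)| > 4ⁿ. Let γ be a 2 × 2 matrix over F with det γ = 1 and γ^m = 1 for some integer m ≥ 1, and suppose the trace of γ lies in 𝓞_F and satisfies tr(γ) − 2 ∈ 𝔫. Then γ is the identity matrix. (This is the key step showing that X_1(𝔫) has no elliptic points when |Nm(𝔫)| > 4ⁿ: any finite-order element of a Hilbert modular group congruent to a unipotent upper-triangular matrix mod 𝔫 is trivial.) -/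
open scoped NumberField

lemma aux_trace_bound (A : Matrix (Fin 2) (Fin 2) ℂ) (hdet : A.det = 1)
    (m : ℕ) (hm : 1 ≤ m) (hord : A ^ m = 1) : ‖A.trace - 2‖ ≤ 4 := by
  obtain ⟨s, hs⟩ := IsAlgClosed.exists_pow_nat_eq (A.trace ^ 2 - 4) (n := 2) (by norm_num)
  obtain ⟨l, hl⟩ : ∃ l : ℂ, l ^ 2 - A.trace * l + 1 = 0 := by
    refine ⟨(A.trace + s) / 2, ?_⟩
    linear_combination hs / 4
  have hd : (A - l • (1 : Matrix (Fin 2) (Fin 2) ℂ)).det = 0 := by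
    rw [Matrix.det_fin_two] at hdet ⊢
    rw [Matrix.trace_fin_two] at hl
    simp
    linear_combination hl + hdet
  obtain ⟨v, hv, hAv⟩ := Matrix.exists_mulVec_eq_zero_iff.mpr hd
  have h1 : A.mulVec v = l • v := by
    rw [Matrix.sub_mulVec, Matrix.smul_mulVec, Matrix.one_mulVec] at hAv
    exact sub_eq_zero.mp hAv
  have h2 : ∀ k : ℕ, (A ^ k).mulVec v = l ^ k • v := by
    intro k
    induction k with
    | zero => simp
    | succ k ih =>
      rw [pow_succ, ← Matrix.mulVec_mulVec, h1, Matrix.mulVec_smul, ih, smul_smul, pow_succ,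
        mul_comm]
  have h3 : l ^ m = 1 := by
    have h := h2 m
    rw [hord, Matrix.one_mulVec] at h
    have h' : (l ^ m - 1) • v = 0 := by rw [sub_smul, one_smul, ← h, sub_self]
    rcases smul_eq_zero.mp h' with h' | h'
    · exact sub_eq_zero.mp h'
    · exact absurd h' hv
  have h4 : ‖l‖ = 1 := Complex.norm_eq_one_of_pow_eq_one h3 (by omega)
  have hl0 : l ≠ 0 := by
    rintro rfl
    simp at h4
  have h5 : A.trace = l + l⁻¹ := by
    field_simp
    linear_combination -hl
  rw [h5]
  calc ‖l + l⁻¹ - 2‖ ≤ ‖l + l⁻¹‖ + ‖(2 : ℂ)‖ := norm_sub_le _ _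
    _ ≤ ‖l‖ + ‖l⁻¹‖ + ‖(2 : ℂ)‖ := by gcongr; exact norm_add_le _ _
    _ ≤ 4 := by rw [norm_inv, h4]; norm_num

/-- No elliptic points on `X_1(𝔫)` for `|Nm 𝔫| > 4ⁿ`: a finite-order `2 × 2` matrix `γ`
over a degree-`n` number field `F` with `det γ = 1` whose trace is an algebraic integer
congruent to `2` modulo a nonzero ideal `𝔫` of norm `> 4ⁿ` must be the identity. -/
theorem finite_order_trace_congruent_two_eq_one (F : Type) [Field F] [NumberField F]
    (n : ℕ) (hn : n = Module.finrank ℚ F)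
    (𝔫 : Ideal (𝓞 F)) (h𝔫 : 𝔫 ≠ ⊥) (hnorm : 4 ^ n < Ideal.absNorm 𝔫)
    (γ : Matrix (Fin 2) (Fin 2) F) (hdet : γ.det = 1)
    (m : ℕ) (hm : 1 ≤ m) (hord : γ ^ m = 1)
    (t : 𝓞 F) (ht : (t : F) = γ.trace) (htm : t - 2 ∈ 𝔫) :
    γ = 1 := by
  have hb : ∀ σ : F →ₐ[ℚ] ℂ, ‖σ ((t - 2 : 𝓞 F) : F)‖ ≤ 4 := by
    intro σ
    have h := aux_trace_bound ((σ : F →+* ℂ).mapMatrix γ)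
      (by rw [← RingHom.map_det, hdet, map_one]) m hm (by rw [← map_pow, hord, map_one])
    have e : σ ((t - 2 : 𝓞 F) : F) = ((σ : F →+* ℂ).mapMatrix γ).trace - 2 := by
      have : ((t - 2 : 𝓞 F) : F) = γ.trace - 2 := by
        rw [← ht]; simp
        exact map_ofNat (algebraMap (𝓞 F) F) 2
      rw [this, Matrix.trace_fin_two, Matrix.trace_fin_two]
      simp
      exact map_ofNat σ 2
    rwa [e]
  have hN : (Algebra.norm ℤ (t - 2)).natAbs ≤ 4 ^ n := by
    have h1 : ‖algebraMap ℚ ℂ (Algebra.norm ℚ ((t - 2 : 𝓞 F) : F))‖ ≤ 4 ^ n := by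
      rw [Algebra.norm_eq_prod_embeddings ℚ ℂ, norm_prod]
      refine (Finset.prod_le_prod (fun _ _ => norm_nonneg _) (fun σ _ => hb σ)).trans ?_
      rw [Finset.prod_const, Finset.card_univ, AlgHom.card, hn]
    rw [← Algebra.coe_norm_int] at h1
    simp only [eq_ratCast, Rat.cast_intCast, Complex.norm_intCast] at h1
    rw [← Nat.cast_le (α := ℝ), Nat.cast_natAbs]
    push_cast
    exact h1
  have ht2 : t - 2 = 0 := by
    by_contra h0
    have hd : Ideal.absNorm 𝔫 ∣ (Algebra.norm ℤ (t - 2)).natAbs := by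
      rw [← Ideal.absNorm_span_singleton]
      exact Ideal.absNorm_dvd_absNorm_of_le ((Ideal.span_singleton_le_iff_mem _).mpr htm)
    have := Nat.le_of_dvd (Int.natAbs_pos.mpr (Algebra.norm_ne_zero_iff.mpr h0)) hd
    omega
  have htr : γ.trace = 2 := by
    rw [← ht, sub_eq_zero.mp ht2]; exact map_ofNat (algebraMap (𝓞 F) F) 2
  have hsq : (γ - 1) * (γ - 1) = 0 := by
    rw [Matrix.det_fin_two] at hdet
    rw [Matrix.trace_fin_two] at htr
    ext i j
    fin_cases i <;> fin_cases j <;> simp [Matrix.mul_apply, Fin.sum_univ_two]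
    · linear_combination γ 0 0 * htr - hdet
    · linear_combination γ 0 1 * htr
    · linear_combination γ 1 0 * htr
    · linear_combination γ 1 1 * htr - hdet
  have hp : ∀ k : ℕ, γ ^ k = 1 + (k : F) • (γ - 1) := by
    intro k
    induction k with
    | zero => simp
    | succ k ih =>
      have : γ ^ (k + 1) = γ ^ k + γ ^ k * (γ - 1) := by rw [pow_succ]; noncomm_ring
      rw [this, ih, add_mul, smul_mul_assoc, hsq, smul_zero, one_mul, add_zero, Nat.cast_succ,
        add_smul, one_smul, add_assoc]
  have h := hp m
  rw [hord, left_eq_add, smul_eq_zero] at h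
  rcases h with h | h
  · exact absurd (Nat.cast_eq_zero.mp h) (by omega)
  · exact sub_eq_zero.mp h
end

section
/- Let F be a number field, let 𝔞 be a nonzero fractional ideal of F, let 𝔫 ⊆ 𝓞_F be a nonzero ideal, let α, β, γ, δ ∈ 𝓞_F, and set Δ = αδ − βγ. Then one has the containment of fractional ideals (Δ²)·𝔞²·𝔫⁻¹ ⊆ (α²𝔞² + β²𝔫⁻¹)·(γ²𝔞² + δ²𝔫⁻¹), where for x ∈ F the symbol x²𝔞² denotes the product of the principal fractional ideal (x²) with 𝔞², and + denotes the sum (supremum) of fractional ideals. -/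
open scoped NumberField nonZeroDivisors

open FractionalIdeal

theorem add_sq_fractional (F : Type) [Field F] [NumberField F]
    (X Y : FractionalIdeal (𝓞 F)⁰ F) : (X + Y) ^ 2 = X ^ 2 + Y ^ 2 := by
  have idem : ∀ Z : FractionalIdeal (𝓞 F)⁰ F, Z + Z = Z := fun Z => by
    rw [← FractionalIdeal.sup_eq_add, sup_idem]
  by_cases h : X + Y = 0
  · have hX : X = 0 := by
      apply le_antisymm _ (FractionalIdeal.zero_le X)
      rw [← h, ← FractionalIdeal.sup_eq_add]
      exact le_sup_left
    subst hX
    simp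
  · apply mul_left_cancel₀ h
    calc (X + Y) * (X + Y) ^ 2
        = X ^ 3 + (X ^ 2 * Y + X ^ 2 * Y + X ^ 2 * Y)
            + (X * Y ^ 2 + X * Y ^ 2 + X * Y ^ 2) + Y ^ 3 := by ring
      _ = X ^ 3 + X ^ 2 * Y + X * Y ^ 2 + Y ^ 3 := by simp only [idem]
      _ = (X + Y) * (X ^ 2 + Y ^ 2) := by ring

/-- For a number field `F`, a nonzero fractional ideal `𝔞`, a nonzero ideal `𝔫 ⊆ 𝓞_F`,
and `α, β, γ, δ ∈ 𝓞_F` with `Δ = αδ - βγ`, one has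
`(Δ²)·𝔞²·𝔫⁻¹ ⊆ (α²𝔞² + β²𝔫⁻¹)·(γ²𝔞² + δ²𝔫⁻¹)` as fractional ideals. -/
theorem spanSingleton_delta_sq_mul_le (F : Type) [Field F] [NumberField F]
    (𝔞 : FractionalIdeal (𝓞 F)⁰ F) (h𝔞 : 𝔞 ≠ 0)
    (𝔫 : Ideal (𝓞 F)) (h𝔫 : 𝔫 ≠ ⊥)
    (α β γ δ : 𝓞 F) :
    spanSingleton (𝓞 F)⁰ (((α * δ - β * γ : 𝓞 F) : F) ^ 2) * 𝔞 ^ 2 *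
        (𝔫 : FractionalIdeal (𝓞 F)⁰ F)⁻¹ ≤
      (spanSingleton (𝓞 F)⁰ ((α : F) ^ 2) * 𝔞 ^ 2 +
          spanSingleton (𝓞 F)⁰ ((β : F) ^ 2) * (𝔫 : FractionalIdeal (𝓞 F)⁰ F)⁻¹) *
        (spanSingleton (𝓞 F)⁰ ((γ : F) ^ 2) * 𝔞 ^ 2 +
          spanSingleton (𝓞 F)⁰ ((δ : F) ^ 2) * (𝔫 : FractionalIdeal (𝓞 F)⁰ F)⁻¹) := by
  have key : spanSingleton (𝓞 F)⁰ (((α * δ - β * γ : 𝓞 F) : F) ^ 2) ≤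
      spanSingleton (𝓞 F)⁰ ((α * δ : F)) ^ 2 + spanSingleton (𝓞 F)⁰ ((β * γ : F)) ^ 2 := by
    rw [← add_sq_fractional, ← spanSingleton_pow]
    have h1 : spanSingleton (𝓞 F)⁰ ((α * δ - β * γ : 𝓞 F) : F) ≤
        spanSingleton (𝓞 F)⁰ ((α * δ : F)) + spanSingleton (𝓞 F)⁰ ((β * γ : F)) := by
      rw [spanSingleton_le_iff_mem, ← FractionalIdeal.mem_coe, FractionalIdeal.coe_add]
      push_cast
      exact Submodule.sub_mem _
        (Submodule.mem_sup_left (mem_spanSingleton_self _ _))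
        (Submodule.mem_sup_right (mem_spanSingleton_self _ _))
    rw [pow_two, pow_two]
    exact mul_le_mul' h1 h1
  generalize (𝔫 : FractionalIdeal (𝓞 F)⁰ F)⁻¹ = N at *
  rw [mul_assoc]
  refine (mul_le_mul' key le_rfl).trans ?_
  simp only [← spanSingleton_pow, ← spanSingleton_mul_spanSingleton]
  generalize spanSingleton (𝓞 F)⁰ (α : F) = a
  generalize spanSingleton (𝓞 F)⁰ (β : F) = b
  generalize spanSingleton (𝓞 F)⁰ (γ : F) = c
  generalize spanSingleton (𝓞 F)⁰ (δ : F) = d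
  calc ((a * d) ^ 2 + (b * c) ^ 2) * (𝔞 ^ 2 * N)
      ≤ ((a * d) ^ 2 + (b * c) ^ 2) * (𝔞 ^ 2 * N)
          + (a ^ 2 * 𝔞 ^ 2 * (c ^ 2 * 𝔞 ^ 2) + b ^ 2 * N * (d ^ 2 * N)) := by
        rw [← FractionalIdeal.sup_eq_add (_ * (𝔞 ^ 2 * N))]
        exact le_sup_left
    _ = _ := by ring
end

section
/- Let F be a number field, let 𝔞 be a nonzero fractional ideal of F, let 𝔫 ⊆ 𝓞_F be a nonzero ideal, let α, β, γ, δ ∈ 𝓞_F with Δ = αδ − βγ ≠ 0. Then Nm(α²𝔞² + β²𝔫⁻¹) · Nm(γ²𝔞² + δ²𝔫⁻¹) ≤ |Nm_{F/ℚ}(Δ)|² · Nm(𝔞)² / Nm(𝔫), where Nm denotes the absolute norm of a fractional ideal (the multiplicative extension of the absolute norm of integral ideals) and Nm_{F/ℚ}(Δ) the field norm of Δ. -/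
open scoped NumberField nonZeroDivisors

open FractionalIdeal

lemma absNorm_anti_aux (F : Type) [Field F] [NumberField F]
    (I J : FractionalIdeal (𝓞 F)⁰ F) (hI : I ≠ 0) (h : I ≤ J) : absNorm J ≤ absNorm I := by
  have hJ : J ≠ 0 := by
    rintro rfl
    exact hI (le_antisymm h (FractionalIdeal.zero_le _))
  have h1 : I * J⁻¹ ≤ 1 := by
    rw [← mul_inv_cancel₀ hJ]
    exact mul_le_mul_left h _
  obtain ⟨K, hK⟩ := le_one_iff_exists_coeIdeal.mp h1
  have hIK : I = (K : FractionalIdeal (𝓞 F)⁰ F) * J := by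
    rw [hK, mul_assoc, inv_mul_cancel₀ hJ, mul_one]
  have hK0 : K ≠ ⊥ := by
    rintro rfl
    apply hI
    rw [hIK]; simp
  have hn : (1 : ℚ) ≤ (Ideal.absNorm K : ℚ) := by
    have : Ideal.absNorm K ≠ 0 := by rwa [Ne, Ideal.absNorm_eq_zero_iff]
    exact_mod_cast Nat.one_le_iff_ne_zero.mpr this
  rw [hIK, map_mul, coeIdeal_absNorm]
  exact le_mul_of_one_le_left (absNorm_nonneg _) hn

lemma mul_mem_aux (F : Type) [Field F] [NumberField F] (u v : F) :
    u * v ∈ spanSingleton (𝓞 F)⁰ (u ^ 2) + spanSingleton (𝓞 F)⁰ (v ^ 2) := by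
  by_cases hu : u = 0
  · subst hu
    rw [zero_mul]; exact Submodule.zero_mem _
  set J := spanSingleton (𝓞 F)⁰ (u ^ 2) + spanSingleton (𝓞 F)⁰ (v ^ 2) with hJd
  have h1 : spanSingleton (𝓞 F)⁰ (u ^ 2) ≤ J := le_sup_left
  have h2 : spanSingleton (𝓞 F)⁰ (v ^ 2) ≤ J := le_sup_right
  have hu2 : u ^ 2 ∈ J := h1 (mem_spanSingleton_self _ _)
  have hv2 : v ^ 2 ∈ J := h2 (mem_spanSingleton_self _ _)
  have hJ : J ≠ 0 := by
    intro h
    rw [h, mem_zero_iff] at hu2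
    exact hu (by simpa using hu2)
  have key : spanSingleton (𝓞 F)⁰ (u * v) * J⁻¹ ≤ 1 := by
    rw [spanSingleton_mul_le_iff]
    intro y hy
    have e1 := (mem_inv_iff hJ).mp hy _ hu2
    have e2 := (mem_inv_iff hJ).mp hy _ hv2
    rw [mem_one_iff] at e1 e2 ⊢
    obtain ⟨a, ha⟩ := e1
    obtain ⟨b, hb⟩ := e2
    have hint : IsIntegral (𝓞 F) (u * v * y) := by
      refine IsIntegral.of_pow (n := 2) (by norm_num) ?_
      have : (u * v * y) ^ 2 = algebraMap (𝓞 F) F (a * b) := by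
        rw [map_mul, ha, hb]; ring
      rw [this]; exact isIntegral_algebraMap
    exact IsIntegrallyClosed.isIntegral_iff.mp hint
  have : spanSingleton (𝓞 F)⁰ (u * v) ≤ J := by
    calc _ = spanSingleton (𝓞 F)⁰ (u * v) * J⁻¹ * J := by
          rw [mul_assoc, inv_mul_cancel₀ hJ, mul_one]
      _ ≤ 1 * J := mul_le_mul_left key _
      _ = J := one_mul _
  exact this (mem_spanSingleton_self _ _)

/-- Norm inequality from the depth estimate: for a nonzero fractional ideal `𝔞`, a nonzero
ideal `𝔫 ⊆ 𝓞_F` and `α, β, γ, δ ∈ 𝓞_F` with `Δ = αδ - βγ ≠ 0`,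
`Nm(α²𝔞² + β²𝔫⁻¹) · Nm(γ²𝔞² + δ²𝔫⁻¹) ≤ |Nm_{F/ℚ}(Δ)|² · Nm(𝔞)² / Nm(𝔫)`. -/
theorem absNorm_sum_mul_absNorm_sum_le (F : Type) [Field F] [NumberField F]
    (𝔞 : FractionalIdeal (𝓞 F)⁰ F) (h𝔞 : 𝔞 ≠ 0)
    (𝔫 : Ideal (𝓞 F)) (h𝔫 : 𝔫 ≠ ⊥)
    (α β γ δ : 𝓞 F) (hΔ : α * δ - β * γ ≠ 0) :
    absNorm (spanSingleton (𝓞 F)⁰ ((α : F) ^ 2) * 𝔞 ^ 2 +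
          spanSingleton (𝓞 F)⁰ ((β : F) ^ 2) * (𝔫 : FractionalIdeal (𝓞 F)⁰ F)⁻¹) *
        absNorm (spanSingleton (𝓞 F)⁰ ((γ : F) ^ 2) * 𝔞 ^ 2 +
          spanSingleton (𝓞 F)⁰ ((δ : F) ^ 2) * (𝔫 : FractionalIdeal (𝓞 F)⁰ F)⁻¹) ≤
      |Algebra.norm ℚ (((α * δ - β * γ : 𝓞 F)) : F)| ^ 2 * absNorm 𝔞 ^ 2 /
        (Ideal.absNorm 𝔫 : ℚ) := by

  set A := 𝔞 ^ 2 with hA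
  set N := (𝔫 : FractionalIdeal (𝓞 F)⁰ F)⁻¹ with hN
  have hA0 : A ≠ 0 := pow_ne_zero _ h𝔞
  have hN0 : N ≠ 0 := inv_ne_zero (coeIdeal_ne_zero.mpr h𝔫)
  set D : F := ((α * δ - β * γ : 𝓞 F) : F) with hD
  have hD0 : D ≠ 0 := by
    rw [hD]; exact_mod_cast hΔ
  have hDe : D = (α : F) * δ - β * γ := by rw [hD]; push_cast; rfl
  have hmem : spanSingleton (𝓞 F)⁰ (D ^ 2) ≤
      spanSingleton (𝓞 F)⁰ (((α : F) * δ) ^ 2) + spanSingleton (𝓞 F)⁰ (((β : F) * γ) ^ 2) := by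
    rw [spanSingleton_le_iff_mem]
    have hm := mul_mem_aux F ((α : F) * δ) (β * γ)
    set J := spanSingleton (𝓞 F)⁰ (((α : F) * δ) ^ 2) +
      spanSingleton (𝓞 F)⁰ (((β : F) * γ) ^ 2) with hJd
    have h1 : spanSingleton (𝓞 F)⁰ (((α : F) * δ) ^ 2) ≤ J := le_sup_left
    have h2 : spanSingleton (𝓞 F)⁰ (((β : F) * γ) ^ 2) ≤ J := le_sup_right
    have hu2 := h1 (mem_spanSingleton_self _ _)
    have hv2 := h2 (mem_spanSingleton_self _ _)
    have e : D ^ 2 = ((α : F) * δ) ^ 2 + ((β : F) * γ) ^ 2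
        - (((α : F) * δ) * (β * γ) + ((α : F) * δ) * (β * γ)) := by rw [hDe]; ring
    rw [e]
    exact Submodule.sub_mem (J : Submodule (𝓞 F) F) (Submodule.add_mem _ hu2 hv2)
      (Submodule.add_mem _ hm hm)
  have hle : spanSingleton (𝓞 F)⁰ (D ^ 2) * (A * N) ≤
      (spanSingleton (𝓞 F)⁰ ((α : F) ^ 2) * A + spanSingleton (𝓞 F)⁰ ((β : F) ^ 2) * N) *
      (spanSingleton (𝓞 F)⁰ ((γ : F) ^ 2) * A + spanSingleton (𝓞 F)⁰ ((δ : F) ^ 2) * N) := by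
    refine (mul_le_mul_left hmem (A * N)).trans ?_
    simp only [mul_pow, ← spanSingleton_mul_spanSingleton]
    generalize spanSingleton (𝓞 F)⁰ ((α : F) ^ 2) = a
    generalize spanSingleton (𝓞 F)⁰ ((β : F) ^ 2) = b
    generalize spanSingleton (𝓞 F)⁰ ((γ : F) ^ 2) = c
    generalize spanSingleton (𝓞 F)⁰ ((δ : F) ^ 2) = d
    have e : (a * A + b * N) * (c * A + d * N) =
      (a * d + b * c) * (A * N) + (a * c * A * A + b * d * N * N) := by ring
    rw [e]
    exact le_sup_left
  have hne : spanSingleton (𝓞 F)⁰ (D ^ 2) * (A * N) ≠ 0 :=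
    mul_ne_zero (spanSingleton_ne_zero_iff.mpr (pow_ne_zero _ hD0)) (mul_ne_zero hA0 hN0)
  have := absNorm_anti_aux F _ _ hne hle
  rw [map_mul] at this
  refine this.trans (le_of_eq ?_)
  rw [map_mul, map_mul, absNorm_span_singleton, hA, hN, map_inv₀, coeIdeal_absNorm, map_pow,
    map_pow, abs_pow, div_eq_mul_inv, mul_assoc]
end
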